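/- Let f ∈ L^p(A) for a bounded open A ⊂ ℝ^d, v a fixed vector, and f_v(x) = f(x+v). Then the sliced p-Cramér distance with uniform measure satisfies SC_p(f, f_v) ≤ K_p · ‖f‖_{M^{p,∞}} · |v|, where K_p = (∫_{S^{d−1}} |u₁|^p du)^{1/p} (uniform probability measure). -/

import Mathlib

open MeasureTheory Real Set
open scoped RealInnerProductSpace ENNReal

/-- Tomographic projection of `f` onto the line spanned by the unit vector `u`. -/
noncomputable def tomoProj {d : ℕ} (u : EuclideanSpace ℝ (Fin d))
    (f : EuclideanSpace ℝ (Fin d) → ℝ) (t : ℝ) : ℝ :=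
  ∫ s in {x : EuclideanSpace ℝ (Fin d) | ⟪x, u⟫ = 0}, f (t • u + s) ∂(μH[(d : ℝ) - 1])

theorem lintegral_rpow_le_measure_univ_rpow_mul {α : Type*} [MeasurableSpace α] {μ : Measure α}
    {F : α → ℝ≥0∞} (hF : AEMeasurable F μ) {p : ℝ} (hp : 1 ≤ p) :
    (∫⁻ x, F x ∂μ) ^ p ≤ μ univ ^ (p - 1) * ∫⁻ x, F x ^ p ∂μ := by
  have hp0 : 0 < p := by linarith
  have h := eLpNorm'_le_eLpNorm'_mul_rpow_measure_univ one_pos hp hF.aestronglyMeasurable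
  simp only [eLpNorm', enorm_eq_self, ENNReal.rpow_one, div_one] at h
  have h2 := ENNReal.rpow_le_rpow h hp0.le
  rw [ENNReal.mul_rpow_of_nonneg _ _ hp0.le, ← ENNReal.rpow_mul, ← ENNReal.rpow_mul,
    one_div_mul_cancel hp0.ne', ENNReal.rpow_one, mul_comm] at h2
  convert h2 using 3
  field_simp

theorem integrableOn_Iic_sub_comp_add_nsmul {g : ℝ → ℝ} {c t : ℝ} (hc : c ≤ 0)
    (h : IntegrableOn (fun s => g s - g (s + c)) (Iic t)) (k : ℕ) :
    IntegrableOn (fun s => g s - g (s + k * c)) (Iic t) := by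
  induction k with
  | zero => simp
  | succ k ih =>
    have h1 : IntegrableOn (fun s => g (s + k * c) - g (s + k * c + c)) (Iic t) := by
      have hk : (k : ℝ) * c ≤ 0 := mul_nonpos_of_nonneg_of_nonpos (Nat.cast_nonneg k) hc
      have h2 := (measurePreserving_add_right volume ((k : ℝ) * c)).integrableOn_comp_preimage
        (measurableEmbedding_addRight _) (f := fun s => g s - g (s + c)) (s := Iic (t + k * c))
      have h3 := h2.2 (h.mono_set (Iic_subset_Iic.2 (by linarith)))
      simpa [Function.comp_def] using h3
    refine (ih.add h1).congr_fun (fun s _ => ?_) measurableSet_Iic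
    simp only [Pi.add_apply]
    push_cast
    ring_nf

theorem integrableOn_Iic_of_sub_comp_add {g : ℝ → ℝ} {r c t : ℝ} (hc : c < 0)
    (hg : ∀ s, s < -r → g s = 0)
    (h : IntegrableOn (fun s => g s - g (s + c)) (Iic t)) :
    IntegrableOn g (Iic t) := by
  obtain ⟨k, hk⟩ := exists_nat_gt ((t + r) / (-c))
  rw [div_lt_iff₀ (by linarith)] at hk
  refine (integrableOn_Iic_sub_comp_add_nsmul hc.le h k).congr_fun (fun s hs => ?_)
    measurableSet_Iic
  have hs' : s ≤ t := hs
  simp only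
  rw [hg (s + k * c) (by linarith), sub_zero]

theorem enorm_setIntegral_Iic_sub_comp_add_le {g : ℝ → ℝ} {r : ℝ}
    (hg : ∀ s, s < -r → g s = 0) (c t : ℝ) :
    ‖∫ s in Iic t, (g s - g (s + c))‖ₑ ≤ ∫⁻ s in uIoc t (t + c), ‖g s‖ₑ := by
  by_cases h : IntegrableOn (fun s => g s - g (s + c)) (Iic t)
  swap
  · rw [integral_undef h]; simp
  rcases eq_or_ne c 0 with rfl | hc0
  · simp
  have key : IntegrableOn g (Iic t) ∧ IntegrableOn (fun s => g (s + c)) (Iic t) := by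
    rcases lt_or_gt_of_ne hc0 with hc | hc
    · have h1 := integrableOn_Iic_of_sub_comp_add hc hg h
      refine ⟨h1, (h1.sub h).congr_fun (fun s _ => ?_) measurableSet_Iic⟩
      simp
    · have h1 : IntegrableOn (fun s => g (s + c)) (Iic t) := by
        refine integrableOn_Iic_of_sub_comp_add (r := r + c) (c := -c) (by linarith)
          (fun s hs => hg _ (by linarith)) ?_
        refine h.neg.congr_fun (fun s _ => ?_) measurableSet_Iic
        simp
      refine ⟨(h.add h1).congr_fun (fun s _ => ?_) measurableSet_Iic, h1⟩
      simp
  have hmp := measurePreserving_add_right (volume : Measure ℝ) c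
  have hme := measurableEmbedding_addRight c
  have hpre : (fun s : ℝ => s + c) ⁻¹' Iic (t + c) = Iic t := by ext; simp
  have h2 : IntegrableOn g (Iic (t + c)) := by
    rw [← hmp.integrableOn_comp_preimage hme, hpre]
    exact key.2
  have h3 : ∫ s in Iic t, g (s + c) = ∫ s in Iic (t + c), g s := by
    rw [← hmp.setIntegral_preimage_emb hme g, hpre]
  rw [integral_sub key.1 key.2, h3, intervalIntegral.integral_Iic_sub_Iic h2 key.1, uIoc_comm]
  rw [← ofReal_norm, intervalIntegral.norm_integral_eq_norm_integral_uIoc, ofReal_norm]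
  exact enorm_integral_le_lintegral_enorm _

theorem lintegral_rpow_setLIntegral_uIoc_le {F : ℝ → ℝ≥0∞} (hF : AEMeasurable F)
    {p : ℝ} (hp : 1 ≤ p) (c : ℝ) :
    ∫⁻ t, (∫⁻ s in uIoc t (t + c), F s) ^ p ≤ ENNReal.ofReal |c| ^ p * ∫⁻ t, F t ^ p := by
  have hp0 : 0 < p := by linarith
  wlog hm : Measurable F generalizing F
  · have h := this hF.measurable_mk.aemeasurable hF.measurable_mk
    have e1 : ∀ t, ∫⁻ s in uIoc t (t + c), F s = ∫⁻ s in uIoc t (t + c), hF.mk F s := fun t =>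
      lintegral_congr_ae (ae_restrict_of_ae hF.ae_eq_mk)
    have e2 : ∫⁻ t, F t ^ p = ∫⁻ t, hF.mk F t ^ p :=
      lintegral_congr_ae (hF.ae_eq_mk.mono fun t ht => by simp only [ht])
    simpa only [e1, e2] using h
  have hshift : ∀ (t : ℝ) (G : ℝ → ℝ≥0∞), ∫⁻ s in uIoc t (t + c), G s =
      ∫⁻ x in uIoc 0 c, G (t + x) := by
    intro t G
    rw [← (measurePreserving_add_left volume t).setLIntegral_comp_preimage_emb
      (measurableEmbedding_addLeft t)]
    congr 2
    ext x
    simp only [mem_preimage, mem_uIoc]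
    constructor <;> rintro (⟨h1, h2⟩ | ⟨h1, h2⟩) <;>
      first | (left; constructor <;> linarith) | (right; constructor <;> linarith)
  have hvol : volume (uIoc (0 : ℝ) c) = ENNReal.ofReal |c| := by simp
  calc ∫⁻ t, (∫⁻ s in uIoc t (t + c), F s) ^ p
      ≤ ∫⁻ t, ENNReal.ofReal |c| ^ (p - 1) * ∫⁻ x in uIoc 0 c, F (t + x) ^ p := by
        refine lintegral_mono fun t => ?_
        rw [hshift]
        refine (lintegral_rpow_le_measure_univ_rpow_mul
          (hm.comp (measurable_const_add t)).aemeasurable hp).trans_eq ?_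
        rw [Measure.restrict_apply_univ, hvol]
        rfl
    _ = ENNReal.ofReal |c| ^ (p - 1) * ∫⁻ x in uIoc 0 c, ∫⁻ t, F (t + x) ^ p := by
        rw [lintegral_const_mul' _ _ (ENNReal.rpow_ne_top_of_nonneg (by linarith)
          ENNReal.ofReal_ne_top), lintegral_lintegral_swap]
        exact ((hm.comp measurable_add).pow_const p).aemeasurable
    _ = ENNReal.ofReal |c| ^ (p - 1) * (ENNReal.ofReal |c| * ∫⁻ t, F t ^ p) := by
        congr 1
        have : ∀ x, ∫⁻ t, F (t + x) ^ p = ∫⁻ t, F t ^ p := fun x =>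
          lintegral_add_right_eq_self (fun t => F t ^ p) x
        simp only [this, lintegral_const, Measure.restrict_apply_univ, hvol]
        rw [mul_comm]
    _ = ENNReal.ofReal |c| ^ p * ∫⁻ t, F t ^ p := by
        rw [← mul_assoc]
        congr 1
        nth_rw 2 [← ENNReal.rpow_one (ENNReal.ofReal |c|)]
        rw [← ENNReal.rpow_add_of_nonneg _ _ (by linarith) zero_le_one]
        ring_nf

theorem enorm_abs_rpow {p : ℝ} (hp : 0 ≤ p) (x : ℝ) :
    ‖|x| ^ p‖ₑ = ‖x‖ₑ ^ p := by
  rw [Real.enorm_of_nonneg (by positivity), ← ENNReal.ofReal_rpow_of_nonneg (abs_nonneg x) hp,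
    Real.enorm_eq_ofReal_abs]

theorem integral_rpow_abs_setIntegral_Iic_sub_le {g G : ℝ → ℝ} {r p : ℝ} (hp : 1 ≤ p)
    (hg : ∀ s, s < -r → g s = 0) (hgG : ∀ s, |g s| ≤ G s) (hG : AEMeasurable G)
    (hGp : Integrable fun t => |G t| ^ p) (c : ℝ) :
    ∫ t, |∫ s in Iic t, (g s - g (s + c))| ^ p ≤ |c| ^ p * ∫ t, |G t| ^ p := by
  have hp0 : 0 ≤ p := by linarith
  have hG0 : 0 ≤ ∫ t, |G t| ^ p := integral_nonneg fun t => by positivity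
  rw [← ENNReal.ofReal_le_ofReal_iff (by positivity)]
  calc ENNReal.ofReal (∫ t, |∫ s in Iic t, (g s - g (s + c))| ^ p)
      ≤ ‖∫ t, |∫ s in Iic t, (g s - g (s + c))| ^ p‖ₑ := Real.ofReal_le_enorm _
    _ ≤ ∫⁻ t, ‖|∫ s in Iic t, (g s - g (s + c))| ^ p‖ₑ := enorm_integral_le_lintegral_enorm _
    _ ≤ ∫⁻ t, (∫⁻ s in uIoc t (t + c), ‖G s‖ₑ) ^ p := by
        refine lintegral_mono fun t => ?_
        rw [enorm_abs_rpow hp0]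
        refine ENNReal.rpow_le_rpow ((enorm_setIntegral_Iic_sub_comp_add_le hg c t).trans ?_) hp0
        refine lintegral_mono fun s => ?_
        rw [Real.enorm_eq_ofReal_abs, Real.enorm_eq_ofReal_abs]
        exact ENNReal.ofReal_le_ofReal ((hgG s).trans (le_abs_self _))
    _ ≤ ENNReal.ofReal |c| ^ p * ∫⁻ t, ‖G t‖ₑ ^ p :=
        lintegral_rpow_setLIntegral_uIoc_le hG.enorm hp c
    _ = ENNReal.ofReal (|c| ^ p * ∫ t, |G t| ^ p) := by
        rw [ENNReal.ofReal_mul (by positivity), ENNReal.ofReal_rpow_of_nonneg (abs_nonneg c) hp0,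
          ofReal_integral_eq_lintegral_ofReal hGp (ae_of_all _ fun t => by positivity)]
        congr 1
        refine lintegral_congr fun t => ?_
        rw [← enorm_abs_rpow hp0, Real.enorm_of_nonneg (by positivity)]

section TomographicProjection

variable {d : ℕ} {e u : EuclideanSpace ℝ (Fin d)}

theorem isAddHaarMeasure_hausdorffMeasure_orthogonal_span_singleton (hd : 0 < d) (he : ‖e‖ = 1) :
    (μH[(d : ℝ) - 1] : Measure (ℝ ∙ e)ᗮ).IsAddHaarMeasure := by
  obtain ⟨n, rfl⟩ : ∃ n, d = n + 1 := ⟨d - 1, by omega⟩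
  have : Fact (Module.finrank ℝ (EuclideanSpace ℝ (Fin (n + 1))) = n + 1) := ⟨by simp⟩
  have he0 : e ≠ 0 := by rintro rfl; simp at he
  have h := isAddHaarMeasure_hausdorffMeasure (E := (ℝ ∙ e)ᗮ)
  rw [Submodule.finrank_orthogonal_span_singleton (n := n) he0] at h
  have hn : (((n + 1 : ℕ) : ℝ) - 1) = n := by push_cast; ring
  rwa [hn]

theorem tomoProj_eq_integral_orthogonal (hd : 0 < d) (f : EuclideanSpace ℝ (Fin d) → ℝ) (t : ℝ) :
    tomoProj e f t = ∫ w : (ℝ ∙ e)ᗮ, f (t • e + w) ∂μH[(d : ℝ) - 1] := by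
  have hd' : (0 : ℝ) ≤ (d : ℝ) - 1 := by
    have : (1 : ℝ) ≤ d := by exact_mod_cast hd
    linarith
  have hset : {x : EuclideanSpace ℝ (Fin d) | ⟪x, e⟫ = 0} =
      range (fun w : (ℝ ∙ e)ᗮ => (w : EuclideanSpace ℝ (Fin d))) := by
    ext x
    simp only [mem_ofPred_eq, mem_range, Subtype.exists, exists_prop, exists_eq_right,
      Submodule.mem_orthogonal_singleton_iff_inner_left]
  have hcl : MeasurableEmbedding (fun w : (ℝ ∙ e)ᗮ => (w : EuclideanSpace ℝ (Fin d))) :=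
    MeasurableEmbedding.subtype_coe (Submodule.isClosed_orthogonal _).measurableSet
  rw [tomoProj, hset, ← isometry_subtype_coe.map_hausdorffMeasure (Or.inl hd'), hcl.integral_map]

theorem tomoProj_map (R : EuclideanSpace ℝ (Fin d) ≃ₗᵢ[ℝ] EuclideanSpace ℝ (Fin d))
    (f : EuclideanSpace ℝ (Fin d) → ℝ) (t : ℝ) :
    tomoProj (R e) f t = tomoProj e (fun x => f (R x)) t := by
  have hR := R.toIsometryEquiv.measurePreserving_hausdorffMeasure ((d : ℝ) - 1)
  have h := hR.setIntegral_preimage_emb R.toHomeomorph.measurableEmbedding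
    (fun s => f (t • R e + s)) {x | ⟪x, R e⟫ = 0}
  rw [tomoProj, tomoProj, ← h]
  simp [LinearIsometryEquiv.inner_map_map]

theorem exists_linearIsometryEquiv_map_eq (h : ‖e‖ = ‖u‖) :
    ∃ R : EuclideanSpace ℝ (Fin d) ≃ₗᵢ[ℝ] EuclideanSpace ℝ (Fin d), R e = u :=
  ⟨(ℝ ∙ (e - u))ᗮ.reflection, Submodule.reflection_sub h⟩

theorem exists_continuousLinearEquiv_prod_orthogonal (he : ‖e‖ = 1) :
    ∃ ψ : (ℝ × (ℝ ∙ e)ᗮ) ≃L[ℝ] EuclideanSpace ℝ (Fin d),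
      ∀ q, ψ q = q.1 • e + q.2 := by
  let L : (ℝ × (ℝ ∙ e)ᗮ) →ₗ[ℝ] EuclideanSpace ℝ (Fin d) :=
    (LinearMap.toSpanSingleton ℝ _ e).coprod (ℝ ∙ e)ᗮ.subtype
  have hL : ∀ q, L q = q.1 • e + q.2 := fun q => by simp [L]
  have hee : ⟪e, e⟫ = (1 : ℝ) := by rw [real_inner_self_eq_norm_sq, he]; norm_num
  have hinj : Function.Injective L := by
    rw [injective_iff_map_eq_zero]
    rintro ⟨t, w⟩ h
    rw [hL] at h
    have he0 : e ≠ 0 := by rintro rfl; simp at he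
    have h1 : t = 0 := by
      have h2 := congrArg (fun x => ⟪e, x⟫) h
      simpa [inner_add_right, inner_smul_right, hee, he0,
        Submodule.mem_orthogonal_singleton_iff_inner_right.1 w.2] using h2
    subst h1
    simpa using h
  have hsurj : Function.Surjective L := by
    intro x
    refine ⟨(⟪e, x⟫, ⟨x - ⟪e, x⟫ • e, ?_⟩), by rw [hL]; simp⟩
    rw [Submodule.mem_orthogonal_singleton_iff_inner_right, inner_sub_right, inner_smul_right, hee]
    simp
  exact ⟨(LinearEquiv.ofBijective L ⟨hinj, hsurj⟩).toContinuousLinearEquiv, fun q => hL q⟩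

theorem norm_sq_smul_add_orthogonal (he : ‖e‖ = 1) (t : ℝ) (w : (ℝ ∙ e)ᗮ) :
    ‖t • e + (w : EuclideanSpace ℝ (Fin d))‖ ^ 2 = t ^ 2 + ‖w‖ ^ 2 := by
  have hw : ⟪t • e, (w : EuclideanSpace ℝ (Fin d))⟫ = 0 := by
    rw [real_inner_smul_left, Submodule.mem_orthogonal_singleton_iff_inner_right.1 w.2, mul_zero]
  rw [sq, norm_add_sq_eq_norm_sq_add_norm_sq_real hw, norm_smul, he]
  simp
  ring

theorem tomoProj_eq_zero (he : ‖e‖ = 1) (hd : 0 < d) {f : EuclideanSpace ℝ (Fin d) → ℝ} {r : ℝ}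
    (hf : ∀ x, r < ‖x‖ → f x = 0) {t : ℝ} (ht : r < |t|) : tomoProj e f t = 0 := by
  rw [tomoProj_eq_integral_orthogonal hd]
  refine integral_eq_zero_of_ae (ae_of_all _ fun w => hf _ (ht.trans_le ?_))
  refine abs_le_of_sq_le_sq ?_ (norm_nonneg _)
  rw [norm_sq_smul_add_orthogonal he]
  nlinarith [sq_nonneg ‖w‖]

theorem abs_tomoProj_le (f : EuclideanSpace ℝ (Fin d) → ℝ) (t : ℝ) :
    |tomoProj e f t| ≤ tomoProj e (fun x => |f x|) t :=
  abs_integral_le_integral_abs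

theorem tomoProj_comp_add_right (hd : 0 < d) (he : ‖e‖ = 1) (f : EuclideanSpace ℝ (Fin d) → ℝ)
    (v : EuclideanSpace ℝ (Fin d)) (t : ℝ) :
    tomoProj e (fun x => f (x + v)) t = tomoProj e f (t + ⟪e, v⟫) := by
  have := isAddHaarMeasure_hausdorffMeasure_orthogonal_span_singleton hd he
  obtain ⟨ψ, hψ⟩ := exists_continuousLinearEquiv_prod_orthogonal he
  obtain ⟨⟨c, w₀⟩, rfl⟩ := ψ.surjective v
  have hc : ⟪e, ψ (c, w₀)⟫ = c := by
    rw [hψ, inner_add_right, inner_smul_right, real_inner_self_eq_norm_sq, he,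
      Submodule.mem_orthogonal_singleton_iff_inner_right.1 w₀.2]
    simp
  rw [hc, tomoProj_eq_integral_orthogonal hd, tomoProj_eq_integral_orthogonal hd,
    
    ← integral_add_right_eq_self (fun w : (ℝ ∙ e)ᗮ => f ((t + c) • e + w)) w₀]
  congr 1
  ext w
  rw [hψ]
  congr 1
  push_cast
  rw [add_smul]
  abel

theorem exists_lintegral_rpow_enorm_tomoProj_le (hd : 0 < d) (he : ‖e‖ = 1) {p : ℝ} (hp : 1 ≤ p)
    (r : ℝ) :
    ∃ C : ℝ≥0∞, C ≠ ⊤ ∧ ∀ f : EuclideanSpace ℝ (Fin d) → ℝ, AEStronglyMeasurable f →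
      (∀ x, r < ‖x‖ → f x = 0) →
      AEStronglyMeasurable (tomoProj e f) ∧
        ∫⁻ t, ‖tomoProj e f t‖ₑ ^ p ≤ C * ∫⁻ x, ‖f x‖ₑ ^ p := by
  have hp0 : 0 ≤ p := by linarith
  have := isAddHaarMeasure_hausdorffMeasure_orthogonal_span_singleton hd he
  set ν : Measure (ℝ ∙ e)ᗮ := μH[(d : ℝ) - 1] with hν
  obtain ⟨ψ, hψ⟩ := exists_continuousLinearEquiv_prod_orthogonal he
  have hψm : MeasurableEmbedding ψ := ψ.toHomeomorph.measurableEmbedding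
  set m : Measure (EuclideanSpace ℝ (Fin d)) := ((volume : Measure ℝ).prod ν).map ψ with hm
  have : m.IsAddHaarMeasure := ψ.isAddHaarMeasure_map _
  have hmc := Measure.isAddLeftInvariant_eq_smul m volume
  set c := m.addHaarScalarFactor volume
  set B : Set (ℝ ∙ e)ᗮ := Metric.closedBall 0 r with hB
  refine ⟨ν B ^ (p - 1) * c, ENNReal.mul_ne_top (ENNReal.rpow_ne_top_of_nonneg (by linarith)
    (isCompact_closedBall _ _).measure_lt_top.ne) ENNReal.coe_ne_top, fun f hf hf0 => ?_⟩
  have hfm : AEStronglyMeasurable f m := by rw [hmc]; exact hf.smul_measure c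
  have hfψ : AEStronglyMeasurable (fun q => f (ψ q)) ((volume : Measure ℝ).prod ν) :=
    hfm.comp_measurable hψm.measurable
  have heq : tomoProj e f = fun t => ∫ w, f (ψ (t, w)) ∂ν := by
    ext t
    simp only [tomoProj_eq_integral_orthogonal hd, hψ, hν]
  have hsupp : ∀ t w, w ∉ B → f (ψ (t, w)) = 0 := by
    intro t w hw
    refine hf0 _ ?_
    rw [hB, mem_closedBall_zero_iff, not_le] at hw
    refine hw.trans_le ?_
    refine le_of_sq_le_sq ?_ (norm_nonneg _)
    rw [hψ, norm_sq_smul_add_orthogonal he]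
    nlinarith [sq_nonneg t]
  refine ⟨by rw [heq]; exact hfψ.integral_prod_right', ?_⟩
  have hae : ∀ᵐ t : ℝ, AEMeasurable (fun w => ‖f (ψ (t, w))‖ₑ) ν :=
    hfψ.prodMk_left.mono fun t ht => ht.enorm
  calc ∫⁻ t, ‖tomoProj e f t‖ₑ ^ p
      ≤ ∫⁻ t, ν B ^ (p - 1) * ∫⁻ w, ‖f (ψ (t, w))‖ₑ ^ p ∂ν := by
        refine lintegral_mono_ae (hae.mono fun t ht => ?_)
        have h1 : ‖tomoProj e f t‖ₑ ≤ ∫⁻ w in B, ‖f (ψ (t, w))‖ₑ ∂ν := by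
          rw [heq, setLIntegral_eq_of_support_subset]
          · exact enorm_integral_le_lintegral_enorm _
          · intro w hw
            by_contra hwB
            exact hw (by simp [hsupp t w hwB])
        refine (ENNReal.rpow_le_rpow h1 hp0).trans ?_
        refine (lintegral_rpow_le_measure_univ_rpow_mul ht.restrict hp).trans ?_
        rw [Measure.restrict_apply_univ]
        gcongr
        exact Measure.restrict_le_self
    _ = ν B ^ (p - 1) * ∫⁻ x, ‖f x‖ₑ ^ p ∂m := by
        rw [lintegral_const_mul' _ _ (ENNReal.rpow_ne_top_of_nonneg (by linarith)
          (isCompact_closedBall _ _).measure_lt_top.ne), hm, hψm.lintegral_map,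
          lintegral_prod _ (hfψ.enorm.pow_const p)]
    _ = ν B ^ (p - 1) * c * ∫⁻ x, ‖f x‖ₑ ^ p := by
        rw [hmc, lintegral_smul_measure, mul_assoc]
        rfl

theorem exists_forall_lintegral_rpow_enorm_tomoProj_le (hd : 0 < d) {p : ℝ} (hp : 1 ≤ p)
    {f : EuclideanSpace ℝ (Fin d) → ℝ} (hf : AEStronglyMeasurable f) {r : ℝ}
    (hf0 : ∀ x, r < ‖x‖ → f x = 0) (hfp : ∫⁻ x, ‖f x‖ₑ ^ p ≠ ⊤) :
    ∃ C : ℝ≥0∞, C ≠ ⊤ ∧ ∀ u : EuclideanSpace ℝ (Fin d), ‖u‖ = 1 →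
      AEStronglyMeasurable (tomoProj u f) ∧ ∫⁻ t, ‖tomoProj u f t‖ₑ ^ p ≤ C := by
  set e : EuclideanSpace ℝ (Fin d) := EuclideanSpace.single ⟨0, hd⟩ 1 with he'
  have he : ‖e‖ = 1 := by simp [he']
  obtain ⟨C, hC, h⟩ := exists_lintegral_rpow_enorm_tomoProj_le hd he hp r
  refine ⟨C * ∫⁻ x, ‖f x‖ₑ ^ p, ENNReal.mul_ne_top hC hfp, fun u hu => ?_⟩
  obtain ⟨R, rfl⟩ := exists_linearIsometryEquiv_map_eq (he.trans hu.symm)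
  have hR := R.measurePreserving
  have h' := h (fun x => f (R x)) (hf.comp_measurePreserving hR)
    (fun x hx => hf0 _ (by rwa [R.norm_map]))
  have hfun : tomoProj (R e) f = tomoProj e (fun x => f (R x)) := funext (tomoProj_map R f)
  rw [hfun]
  refine ⟨h'.1, h'.2.trans_eq ?_⟩
  rw [hR.lintegral_comp_emb R.toHomeomorph.measurableEmbedding (fun x => ‖f x‖ₑ ^ p)]

theorem setIntegral_sphere_abs_inner_rpow (he : ‖e‖ = 1) (s p : ℝ)
    (v : EuclideanSpace ℝ (Fin d)) :
    ∫ u in Metric.sphere (0 : EuclideanSpace ℝ (Fin d)) 1, |⟪u, v⟫| ^ p ∂μH[s] =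
      ‖v‖ ^ p * ∫ u in Metric.sphere (0 : EuclideanSpace ℝ (Fin d)) 1, |⟪u, e⟫| ^ p ∂μH[s] := by
  obtain ⟨R, hR⟩ := exists_linearIsometryEquiv_map_eq (e := ‖v‖ • e) (u := v)
    (by rw [norm_smul, he]; simp)
  have hmp := R.toIsometryEquiv.measurePreserving_hausdorffMeasure s
  have h := hmp.setIntegral_preimage_emb R.toHomeomorph.measurableEmbedding
    (fun u => |⟪u, v⟫| ^ p) (Metric.sphere 0 1)
  have hpre : R.toIsometryEquiv ⁻¹' Metric.sphere 0 1 = Metric.sphere 0 1 := by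
    ext x; simp
  rw [← h, hpre, ← integral_const_mul]
  congr 1
  ext u
  nth_rw 1 [← hR]
  simp only [LinearIsometryEquiv.coe_toIsometryEquiv, LinearIsometryEquiv.inner_map_map,
    inner_smul_right, abs_mul, abs_norm]
  rw [Real.mul_rpow (norm_nonneg _) (abs_nonneg _)]

end TomographicProjection

/-- Translation bound for the sliced `p`-Cramér distance with the uniform measure on
the sphere: for `f ∈ L^p(A)` (A bounded open) and `f_v(x) = f(x+v)`,
`SC_p(f, f_v) ≤ K_p · ‖f‖_{M^{p,∞}} · |v|`, where
`K_p = (∫_{S^{d−1}} |u₁|^p du)^{1/p}` for the uniform probability measure. -/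
theorem sliced_cramer_translation {d : ℕ} (hd : 0 < d)
    (A : Set (EuclideanSpace ℝ (Fin d))) (hA : IsOpen A) (hAb : Bornology.IsBounded A)
    (hAne : A.Nonempty)
    (p : ℝ) (hp : 1 ≤ p)
    (f : EuclideanSpace ℝ (Fin d) → ℝ)
    (hf : Integrable (fun x => |f x| ^ p)) (hf0 : ∀ x, x ∉ A → f x = 0)
    (v : EuclideanSpace ℝ (Fin d))
    (fv : EuclideanSpace ℝ (Fin d) → ℝ) (hfv : ∀ x, fv x = f (x + v)) :
    ((μH[(d : ℝ) - 1] (Metric.sphere (0 : EuclideanSpace ℝ (Fin d)) 1)).toReal⁻¹ *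
        ∫ u in Metric.sphere (0 : EuclideanSpace ℝ (Fin d)) 1,
          (∫ t : ℝ, |∫ s in Iic t, (tomoProj u f s - tomoProj u fv s)| ^ p)
            ∂(μH[(d : ℝ) - 1])) ^ (1 / p) ≤
      (((μH[(d : ℝ) - 1] (Metric.sphere (0 : EuclideanSpace ℝ (Fin d)) 1)).toReal⁻¹ *
          ∫ u in Metric.sphere (0 : EuclideanSpace ℝ (Fin d)) 1,
            |u ⟨0, hd⟩| ^ p ∂(μH[(d : ℝ) - 1])) ^ (1 / p)) *
        sSup { r : ℝ | ∃ u : EuclideanSpace ℝ (Fin d), ‖u‖ = 1 ∧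
          r = (∫ t : ℝ, |tomoProj u (fun x => |f x|) t| ^ p) ^ (1 / p) } *
        ‖v‖ := by
  have hp0 : 0 < p := by linarith
  obtain ⟨r, hr⟩ := hAb.subset_closedBall 0
  have hfr : ∀ x, r < ‖x‖ → f x = 0 := fun x hx =>
    hf0 x fun hxA => absurd (mem_closedBall_zero_iff.1 (hr hxA)) (not_le.2 hx)
  have hfabs : AEStronglyMeasurable (fun x => |f x|) := by
    have h : (fun x => |f x|) = fun x => (|f x| ^ p) ^ p⁻¹ := by
      ext x
      rw [Real.rpow_rpow_inv (abs_nonneg _) hp0.ne']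
    rw [h]
    exact (hf.aemeasurable.pow_const _).aestronglyMeasurable
  have hfp : ∫⁻ x, ‖|f x|‖ₑ ^ p ≠ ⊤ := by
    have h := hf.2.ne
    simpa only [← enorm_abs_rpow hp0.le, abs_abs] using h
  obtain ⟨C, hC, hCu⟩ := exists_forall_lintegral_rpow_enorm_tomoProj_le hd hp hfabs
    (fun x hx => by rw [hfr x hx, abs_zero]) hfp
  set G : EuclideanSpace ℝ (Fin d) → ℝ → ℝ := fun u => tomoProj u (fun x => |f x|)
  have hGint : ∀ u, ‖u‖ = 1 → Integrable fun t => |G u t| ^ p := by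
    intro u hu
    refine ⟨((hCu u hu).1.aemeasurable.abs.pow_const p).aestronglyMeasurable, ?_⟩
    simp only [HasFiniteIntegral, enorm_abs_rpow hp0.le]
    exact (hCu u hu).2.trans_lt hC.lt_top
  have hG0 : ∀ u, 0 ≤ ∫ t, |G u t| ^ p := fun u => integral_nonneg fun t => by positivity
  have hGC : ∀ u, ‖u‖ = 1 → ∫ t, |G u t| ^ p ≤ C.toReal := by
    intro u hu
    rw [← ENNReal.ofReal_le_iff_le_toReal hC, ofReal_integral_eq_lintegral_ofReal (hGint u hu)
      (ae_of_all _ fun t => by positivity)]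
    refine (lintegral_congr fun t => ?_).trans_le (hCu u hu).2
    rw [← enorm_abs_rpow hp0.le, Real.enorm_of_nonneg (by positivity)]
  set S := { r : ℝ | ∃ u : EuclideanSpace ℝ (Fin d), ‖u‖ = 1 ∧
    r = (∫ t : ℝ, |tomoProj u (fun x => |f x|) t| ^ p) ^ (1 / p) }
  have hSbdd : BddAbove S := by
    refine ⟨C.toReal ^ (1 / p), ?_⟩
    rintro _ ⟨u, hu, rfl⟩
    exact Real.rpow_le_rpow (hG0 u) (hGC u hu) (by positivity)
  have hS0 : 0 ≤ sSup S := by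
    refine Real.sSup_nonneg ?_
    rintro _ ⟨u, hu, rfl⟩
    exact Real.rpow_nonneg (hG0 u) _
  have hGS : ∀ u, ‖u‖ = 1 → ∫ t, |G u t| ^ p ≤ sSup S ^ p := by
    intro u hu
    rw [← Real.rpow_inv_le_iff_of_pos (hG0 u) hS0 hp0, ← one_div]
    exact le_csSup hSbdd ⟨u, hu, rfl⟩
  have hfv' : fv = fun x => f (x + v) := funext hfv
  have hinner : ∀ u, ‖u‖ = 1 →
      ∫ t : ℝ, |∫ s in Iic t, (tomoProj u f s - tomoProj u fv s)| ^ p ≤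
        |⟪u, v⟫| ^ p * sSup S ^ p := by
    intro u hu
    have h := integral_rpow_abs_setIntegral_Iic_sub_le hp (r := r)
      (fun s hs => tomoProj_eq_zero hu hd hfr (by
        have := neg_le_abs s
        linarith)) (abs_tomoProj_le (e := u) f) (hCu u hu).1.aemeasurable (hGint u hu) ⟪u, v⟫
    simp only [hfv', tomoProj_comp_add_right hd hu]
    exact h.trans (mul_le_mul_of_nonneg_left (hGS u hu) (by positivity))
  set σ : Measure (EuclideanSpace ℝ (Fin d)) := μH[(d : ℝ) - 1] with hσ
  have hK0 : 0 ≤ ∫ u in Metric.sphere (0 : EuclideanSpace ℝ (Fin d)) 1, |u ⟨0, hd⟩| ^ p ∂σ :=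
    integral_nonneg fun u => by positivity
  by_cases htop : σ (Metric.sphere 0 1) = ⊤
  · rw [htop]
    simp only [ENNReal.toReal_top, inv_zero, zero_mul]
    rw [Real.zero_rpow (by positivity)]
    simp
  have hint : IntegrableOn (fun u => |⟪u, v⟫| ^ p * sSup S ^ p) (Metric.sphere 0 1) σ := by
    have : IsFiniteMeasure (σ.restrict (Metric.sphere 0 1)) :=
      ⟨by rw [Measure.restrict_apply_univ]; exact lt_top_iff_ne_top.2 htop⟩
    refine Integrable.of_bound (C := ‖v‖ ^ p * sSup S ^ p) ?_ ?_
    · refine Continuous.aestronglyMeasurable ?_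
      exact ((continuous_id.inner continuous_const).abs.rpow_const
        fun _ => Or.inr hp0.le).mul continuous_const
    · refine (ae_restrict_mem Metric.isClosed_sphere.measurableSet).mono fun u hu => ?_
      rw [mem_sphere_zero_iff_norm] at hu
      rw [Real.norm_of_nonneg (by positivity)]
      gcongr
      simpa [hu] using abs_real_inner_le_norm u v
  have hmain : ∫ u in Metric.sphere (0 : EuclideanSpace ℝ (Fin d)) 1,
      (∫ t : ℝ, |∫ s in Iic t, (tomoProj u f s - tomoProj u fv s)| ^ p) ∂σ ≤
      (∫ u in Metric.sphere (0 : EuclideanSpace ℝ (Fin d)) 1, |u ⟨0, hd⟩| ^ p ∂σ) *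
        (sSup S * ‖v‖) ^ p := by
    calc _ ≤ ∫ u in Metric.sphere (0 : EuclideanSpace ℝ (Fin d)) 1,
          |⟪u, v⟫| ^ p * sSup S ^ p ∂σ := by
          refine integral_mono_of_nonneg
            (ae_of_all _ fun u => integral_nonneg fun t => by positivity) hint ?_
          refine (ae_restrict_mem Metric.isClosed_sphere.measurableSet).mono fun u hu => ?_
          exact hinner u (mem_sphere_zero_iff_norm.1 hu)
      _ = _ := by
          have he : ‖(EuclideanSpace.single ⟨0, hd⟩ 1 : EuclideanSpace ℝ (Fin d))‖ = 1 := by simp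
          rw [integral_mul_const, hσ, setIntegral_sphere_abs_inner_rpow he,
            Real.mul_rpow hS0 (norm_nonneg _)]
          simp only [EuclideanSpace.inner_single_right, one_mul, conj_trivial]
          ring
  have hc0 : 0 ≤ (σ (Metric.sphere 0 1)).toReal⁻¹ := by positivity
  calc _ ≤ ((σ (Metric.sphere 0 1)).toReal⁻¹ *
        ((∫ u in Metric.sphere (0 : EuclideanSpace ℝ (Fin d)) 1, |u ⟨0, hd⟩| ^ p ∂σ) *
          (sSup S * ‖v‖) ^ p)) ^ (1 / p) := by
        refine Real.rpow_le_rpow (mul_nonneg hc0 (integral_nonneg fun u =>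
          integral_nonneg fun t => by positivity)) ?_ (by positivity)
        exact mul_le_mul_of_nonneg_left hmain hc0
    _ = _ := by
        rw [← mul_assoc, Real.mul_rpow (mul_nonneg hc0 hK0) (by positivity), ← Real.rpow_mul
          (by positivity), mul_one_div_cancel hp0.ne', Real.rpow_one, mul_assoc _ (sSup S)]
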